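/- Let m_1, m_2 ≥ 3 and n = m_1+m_2−1 with n ≥ 7. Then ε(C_{3,3}^n) > ε(C_{m_1,m_2}^n). -/

import Mathlib

open SimpleGraph

/-- The eccentricity of a vertex: maximum distance to any vertex. -/
noncomputable def ecc {V : Type*} (G : SimpleGraph V) (v : V) : ℕ :=
  ⨆ u, G.dist v u

/-- The total eccentricity index: sum of eccentricities of all vertices. -/
noncomputable def totalEcc {V : Type*} [Fintype V] (G : SimpleGraph V) : ℕ :=
  ∑ v, ecc G v

/-- A pendant vertex: a vertex of degree one, i.e. with exactly one neighbour. -/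
def IsPendant {V : Type*} (G : SimpleGraph V) (v : V) : Prop :=
  ∃! u, G.Adj v u

/-- A cut vertex: a vertex whose removal disconnects the graph. -/
def IsCutVertex {V : Type*} (G : SimpleGraph V) (w : V) : Prop :=
  ¬ (G.induce {v | v ≠ w}).Connected

/-- distance between two subgraphs -/
noncomputable def subgraphDist {V : Type*} (G : SimpleGraph V) (B B' : G.Subgraph) : ℕ :=
  sInf {d | ∃ u ∈ B.verts, ∃ w ∈ B'.verts, G.dist u w = d}

/-- A 2-connected subgraph: at least two vertices, connected, and no cut vertex. -/
def TwoConn {V : Type*} {G : SimpleGraph V} (H : G.Subgraph) : Prop :=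
  2 ≤ H.verts.ncard ∧ H.coe.Connected ∧ ∀ w, ¬ IsCutVertex H.coe w

/-- A block: a maximal 2-connected subgraph. -/
def IsBlock {V : Type*} {G : SimpleGraph V} (H : G.Subgraph) : Prop :=
  TwoConn H ∧ ∀ H' : G.Subgraph, H ≤ H' → TwoConn H' → H' = H

/-- A pendant block: a block containing exactly one cut vertex of `G`. -/
def IsPendantBlock {V : Type*} (G : SimpleGraph V) (H : G.Subgraph) : Prop :=
  ∃! w, w ∈ H.verts ∧ IsCutVertex G w

/-- `G_{k,l}`: the graph obtained from `G` by attaching two new paths,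
with `k` resp. `l` new vertices, at the vertex `v`. -/
def attachTwoPaths {V : Type*} (G : SimpleGraph V) (v : V) (k l : ℕ) :
    SimpleGraph (V ⊕ (Fin k ⊕ Fin l)) :=
  SimpleGraph.fromRel (fun p q =>
    match p, q with
    | .inl x, .inl y => G.Adj x y
    | .inl x, .inr (.inl i) => x = v ∧ i.val = 0
    | .inl x, .inr (.inr i) => x = v ∧ i.val = 0
    | .inr (.inl i), .inr (.inl j) => i.val + 1 = j.val
    | .inr (.inr i), .inr (.inr j) => i.val + 1 = j.val
    | _, _ => False)

/-- The graph obtained from `H1`, `H2` and the path `P_d = v_1 v_2 … v_d` by identifying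
`u ∈ V(H1)`, `v ∈ V(H2)` and `v_1` into a single vertex.  The `Fin (d-1)` part records the
path vertices `v_2, …, v_d`. -/
def glueMid {V1 V2 : Type*} (H1 : SimpleGraph V1) (H2 : SimpleGraph V2)
    (u : V1) (v : V2) (d : ℕ) :
    SimpleGraph (V1 ⊕ ({x : V2 // x ≠ v} ⊕ Fin (d - 1))) :=
  SimpleGraph.fromRel (fun p q =>
    match p, q with
    | .inl x, .inl y => H1.Adj x y
    | .inl x, .inr (.inl y) => x = u ∧ H2.Adj v y.1
    | .inl x, .inr (.inr i) => x = u ∧ i.val = 0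
    | .inr (.inl x), .inr (.inl y) => H2.Adj x.1 y.1
    | .inr (.inr i), .inr (.inr j) => i.val + 1 = j.val
    | _, _ => False)

/-- The graph obtained from `H1`, `H2` and the path `P_d = v_1 v_2 … v_d` by identifying
`u ∈ V(H1)` with `v_1` and `v ∈ V(H2)` with `v_d`.  The `Fin (d-1)` part records the path
vertices `v_2, …, v_d` (the last one being identified with `v`). -/
def glueEnds {V1 V2 : Type*} (H1 : SimpleGraph V1) (H2 : SimpleGraph V2)
    (u : V1) (v : V2) (d : ℕ) :
    SimpleGraph (V1 ⊕ ({x : V2 // x ≠ v} ⊕ Fin (d - 1))) :=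
  SimpleGraph.fromRel (fun p q =>
    match p, q with
    | .inl x, .inl y => H1.Adj x y
    | .inl x, .inr (.inr i) => x = u ∧ i.val = 0
    | .inr (.inl x), .inr (.inl y) => H2.Adj x.1 y.1
    | .inr (.inr i), .inr (.inl y) => i.val + 1 = d - 1 ∧ H2.Adj v y.1
    | .inr (.inr i), .inr (.inr j) => i.val + 1 = j.val
    | _, _ => False)

/-- `U_{n,g}^l`: the unicyclic graph on `n` vertices obtained by joining one end vertex of
the path `P_{n-g}` to a vertex of the cycle `C_g` by an edge. -/
def UnlGraph (n g : ℕ) : SimpleGraph (Fin (n - g) ⊕ Fin g) :=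
  SimpleGraph.fromRel (fun p q =>
    match p, q with
    | .inl i, .inl j => i.val + 1 = j.val
    | .inl i, .inr j => i.val + 1 = n - g ∧ j.val = 0
    | .inr i, .inr j => i.val + 1 = j.val ∨ (i.val = 0 ∧ j.val + 1 = g)
    | _, _ => False)

/-- `U_{n,g}^p`: the unicyclic graph on `n` vertices obtained by attaching `n - g` pendant
vertices to one vertex of the cycle `C_g`. -/
def UnpGraph (n g : ℕ) : SimpleGraph (Fin g ⊕ Fin (n - g)) :=
  SimpleGraph.fromRel (fun p q =>
    match p, q with
    | .inl i, .inl j => i.val + 1 = j.val ∨ (i.val = 0 ∧ j.val + 1 = g)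
    | .inl i, .inr _ => i.val = 0
    | _, _ => False)

/-- The graph obtained by joining the vertex `u` of `H` to the pendant vertex of
`U_{r,g}^l` by an edge. -/
def joinPendant {V : Type*} (H : SimpleGraph V) (u : V) (r g : ℕ) :
    SimpleGraph (V ⊕ (Fin (r - g) ⊕ Fin g)) :=
  SimpleGraph.fromRel (fun p q =>
    match p, q with
    | .inl x, .inl y => H.Adj x y
    | .inl x, .inr (.inl i) => x = u ∧ i.val = 0
    | .inr a, .inr b => (UnlGraph r g).Adj a b
    | _, _ => False)

/-- `C_{m1,m2}^n` in the case `n = m1 + m2 - 1`: two cycles `C_{m1}` and `C_{m2}`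
sharing exactly one vertex (the vertex `0`). -/
def twoCyclesGlued (m1 m2 : ℕ) : SimpleGraph (Fin (m1 + m2 - 1)) :=
  SimpleGraph.fromRel (fun i j =>
    (i.val + 1 = j.val ∧ j.val < m1) ∨ (i.val = 0 ∧ j.val + 1 = m1)
    ∨ (i.val = 0 ∧ j.val = m1) ∨ (m1 ≤ i.val ∧ i.val + 1 = j.val)
    ∨ (i.val = 0 ∧ j.val + 2 = m1 + m2))

/-- `C_{3,3}^n` for `n > 5`: two triangles `{0,1,2}` and `{n-3,n-2,n-1}` joined by the path
`2, 3, …, n-3` (a path on `n - 4` vertices whose ends are identified with a vertex of each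
triangle). -/
def C33 (n : ℕ) : SimpleGraph (Fin n) :=
  SimpleGraph.fromRel (fun i j =>
    (i.val = 0 ∧ j.val = 1) ∨ (i.val = 0 ∧ j.val = 2) ∨ (i.val = 1 ∧ j.val = 2)
    ∨ (2 ≤ i.val ∧ i.val + 1 = j.val ∧ j.val + 3 ≤ n)
    ∨ (i.val + 3 = n ∧ j.val + 2 = n) ∨ (i.val + 2 = n ∧ j.val + 1 = n)
    ∨ (i.val + 3 = n ∧ j.val + 1 = n))

/-- `T(l, m, d)`: the tree obtained from the path `P_d` by attaching `l` pendant vertices at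
one end and `m` pendant vertices at the other end. -/
def Tlmd (l m d : ℕ) : SimpleGraph (Fin d ⊕ (Fin l ⊕ Fin m)) :=
  SimpleGraph.fromRel (fun p q =>
    match p, q with
    | .inl i, .inl j => i.val + 1 = j.val
    | .inl i, .inr (.inl _) => i.val = 0
    | .inl i, .inr (.inr _) => i.val + 1 = d
    | _, _ => False)

/-- `K_m^n(l_1, …, l_m)`: the graph obtained from the complete graph `K_m` by identifying,
for each `i`, one end vertex of a path on `l i` vertices with the `i`-th vertex of `K_m`.
The vertex `⟨i, 0⟩` is the `i`-th vertex of the complete graph. -/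
def Kmn (m : ℕ) (l : Fin m → ℕ) : SimpleGraph ((i : Fin m) × Fin (l i)) :=
  SimpleGraph.fromRel (fun p q =>
    (p.1 = q.1 ∧ p.2.val + 1 = q.2.val) ∨ (p.1 ≠ q.1 ∧ p.2.val = 0 ∧ q.2.val = 0))

/-- The graph obtained from `H`, `C_{m1}` and `C_{m2}` by identifying the vertex `w` of `H`,
a vertex of `C_{m1}` and a vertex of `C_{m2}` into one vertex. -/
def glueTwoCycles {V : Type*} (H : SimpleGraph V) (w : V) (m1 m2 : ℕ) :
    SimpleGraph (V ⊕ (Fin (m1 - 1) ⊕ Fin (m2 - 1))) :=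
  SimpleGraph.fromRel (fun p q =>
    match p, q with
    | .inl x, .inl y => H.Adj x y
    | .inl x, .inr (.inl i) => x = w ∧ (i.val = 0 ∨ i.val + 2 = m1)
    | .inl x, .inr (.inr i) => x = w ∧ (i.val = 0 ∨ i.val + 2 = m2)
    | .inr (.inl i), .inr (.inl j) => i.val + 1 = j.val
    | .inr (.inr i), .inr (.inr j) => i.val + 1 = j.val
    | _, _ => False)

/-- The graph obtained from `H` and the cycle `C_M` by identifying the vertex `w` of `H`
with one vertex of the cycle. -/
def glueOneCycle {V : Type*} (H : SimpleGraph V) (w : V) (M : ℕ) :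
    SimpleGraph (V ⊕ Fin (M - 1)) :=
  SimpleGraph.fromRel (fun p q =>
    match p, q with
    | .inl x, .inl y => H.Adj x y
    | .inl x, .inr i => x = w ∧ (i.val = 0 ∨ i.val + 2 = M)
    | .inr i, .inr j => i.val + 1 = j.val
    | _, _ => False)

lemma ecc_le_of_dist_le {V : Type*} {G : SimpleGraph V} {v : V} {k : ℕ}
    (h : ∀ u, G.dist v u ≤ k) : ecc G v ≤ k :=
  haveI : Nonempty V := ⟨v⟩
  ciSup_le h

lemma dist_le_ecc {V : Type*} [Finite V] (G : SimpleGraph V) (v u : V) :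
    G.dist v u ≤ ecc G v :=
  le_ciSup (f := fun u => G.dist v u) (Set.finite_range _).bddAbove u

/-- Consecutive adjacent vertices of a graph on `Fin N` form a walk. -/
lemma exists_walk_of_consecutive {N : ℕ} (G : SimpleGraph (Fin N)) {i j : ℕ} (hij : i ≤ j)
    (hj : j < N)
    (h : ∀ k (hk : k + 1 < N), i ≤ k → k < j → G.Adj ⟨k, by omega⟩ ⟨k + 1, hk⟩) :
    ∃ p : G.Walk ⟨i, by omega⟩ ⟨j, hj⟩, p.length = j - i := by
  induction j, hij using Nat.le_induction with
  | base => exact ⟨.nil, by simp⟩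
  | succ j hij ih =>
    obtain ⟨p, hp⟩ := ih (by omega) fun k hk h1 h2 => h k hk h1 (by omega)
    refine ⟨p.concat (h j hj hij (by omega)), ?_⟩
    rw [Walk.length_concat, hp]
    omega

lemma le_add_length_of_adj {V : Type*} {G : SimpleGraph V} {φ : V → ℕ}
    (h : ∀ u v, G.Adj u v → φ v ≤ φ u + 1) {u v : V} (p : G.Walk u v) :
    φ v ≤ φ u + p.length := by
  induction p with
  | nil => simp
  | cons huv p ih =>
    have := h _ _ huv
    rw [Walk.length_cons]
    omega

lemma C33_connected {n : ℕ} (hn : 5 ≤ n) : (C33 n).Connected := by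
  have h0 : ∀ v : Fin n, (C33 n).Reachable ⟨0, by omega⟩ v := fun v => by
    obtain ⟨p, -⟩ := exists_walk_of_consecutive (C33 n) (Nat.zero_le v.val) v.isLt
      fun k hk _ _ => by
        refine (fromRel_adj _ _ _).2 ⟨by simp, .inl ?_⟩
        simp only [true_and]
        omega
    exact ⟨p⟩
  exact { preconnected := fun u v => (h0 u).symm.trans (h0 v), nonempty := ⟨⟨0, by omega⟩⟩ }

/-- The distance in `C33 n` from the vertex `0` to the vertex `i`, for `i ≠ 1`; the vertex `1`
is given the value `0` as well. -/
def C33Position (n i : ℕ) : ℕ := min (i - 1) (n - 3)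

lemma C33Position_le_of_adj {n : ℕ} (hn : 5 ≤ n) (u v : Fin n) (h : (C33 n).Adj u v) :
    C33Position n v ≤ C33Position n u + 1 := by
  simp only [C33, fromRel_adj] at h
  have := u.isLt
  have := v.isLt
  unfold C33Position
  omega

lemma le_ecc_C33 {n : ℕ} (hn : 5 ≤ n) (v : Fin n) :
    max (C33Position n v) (n - 3 - C33Position n v) ≤ ecc (C33 n) v := by
  have key : ∀ u w : Fin n,
      C33Position n w ≤ C33Position n u + (C33 n).dist u w := fun u w => by
    obtain ⟨p, hp⟩ := (C33_connected hn).exists_walk_length_eq_dist u w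
    rw [← hp]
    exact le_add_length_of_adj (φ := fun x : Fin n => C33Position n x)
      (C33Position_le_of_adj hn) p
  have h0 := key ⟨0, by omega⟩ v
  have h1 := key v ⟨n - 1, by omega⟩
  rw [SimpleGraph.dist_comm] at h0
  have e0 := dist_le_ecc (C33 n) v ⟨0, by omega⟩
  have e1 := dist_le_ecc (C33 n) v ⟨n - 1, by omega⟩
  have z0 : C33Position n 0 = 0 := by simp [C33Position]
  have z1 : C33Position n (n - 1) = n - 3 := by unfold C33Position; omega
  simp only [z0, z1] at h0 h1
  omega

lemma sum_le_totalEcc_C33 {n : ℕ} (hn : 5 ≤ n) :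
    ∑ i ∈ Finset.range n, max (C33Position n i) (n - 3 - C33Position n i) ≤
      totalEcc (C33 n) := by
  rw [totalEcc, Finset.sum_range]
  exact Finset.sum_le_sum fun v _ => le_ecc_C33 hn v

lemma le_two_mul_sum_range_C33Position {n : ℕ} (hn : 5 ≤ n) {t : ℕ} (ht : t ≤ n - 2) :
    2 * (n - 3) + 2 * t * (n - 3) + t ≤
      2 * ∑ i ∈ Finset.range (t + 1), max (C33Position n i) (n - 3 - C33Position n i) + t ^ 2 := by
  induction t with
  | zero => simp [C33Position]
  | succ t ih =>
    specialize ih (by omega)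
    rw [Finset.sum_range_succ]
    have h : n - 3 ≤ max (C33Position n (t + 1)) (n - 3 - C33Position n (t + 1)) + t := by
      unfold C33Position
      omega
    nlinarith

lemma le_two_mul_sum_Ico_C33Position {n : ℕ} (hn : 5 ≤ n) {t s : ℕ} (hts : t + s + 3 ≤ n) :
    2 * s * (t + 1) + s ^ 2 ≤
      2 * ∑ i ∈ Finset.range s, max (C33Position n (t + 2 + i))
        (n - 3 - C33Position n (t + 2 + i)) + s := by
  induction s with
  | zero => simp
  | succ s ih =>
    specialize ih (by omega)
    rw [Finset.sum_range_succ]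
    have h : t + 1 + s ≤ max (C33Position n (t + 2 + s))
        (n - 3 - C33Position n (t + 2 + s)) := by
      unfold C33Position
      omega
    nlinarith

lemma le_two_mul_totalEcc_C33 {t s : ℕ} (hts : 2 ≤ t + s) :
    2 * (t + s) * (t + 3) + (t + 1) + 2 * s * (t + 1) + s ^ 2 ≤
      2 * totalEcc (C33 (t + s + 3)) + (t + 1) ^ 2 + s := by
  have h := sum_le_totalEcc_C33 (n := t + s + 3) (by omega)
  have hl := le_two_mul_sum_range_C33Position (n := t + s + 3) (t := t + 1) (by omega) (by omega)
  have hr := le_two_mul_sum_Ico_C33Position (n := t + s + 3) (t := t) (s := s) (by omega) le_rfl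
  have hlast : t + s ≤ max (C33Position (t + s + 3) (t + 2 + s))
      (t + s + 3 - 3 - C33Position (t + s + 3) (t + 2 + s)) := by
    unfold C33Position
    omega
  have hn : Finset.range (t + s + 3) = Finset.range (t + 1 + 1 + (s + 1)) := by
    congr 1
    omega
  rw [hn, Finset.sum_range_add, Finset.sum_range_succ _ s] at h
  simp only [Nat.add_sub_cancel] at h hl hr hlast
  nlinarith

section twoCyclesGlued

variable {m1 m2 : ℕ}

lemma twoCyclesGlued_adj_succ {k : ℕ} (hk : k + 1 < m1 + m2 - 1) (h : k + 1 ≠ m1) :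
    (twoCyclesGlued m1 m2).Adj ⟨k, by omega⟩ ⟨k + 1, hk⟩ := by
  simp only [twoCyclesGlued, fromRel_adj, ne_eq, Fin.ext_iff, true_and, and_true]
  omega

lemma twoCyclesGlued_exists_walk {i j : ℕ} (hij : i ≤ j) (hj : j < m1 + m2 - 1)
    (h : j < m1 ∨ m1 ≤ i) :
    ∃ p : (twoCyclesGlued m1 m2).Walk ⟨i, by omega⟩ ⟨j, hj⟩, p.length = j - i :=
  exists_walk_of_consecutive _ hij hj fun k hk _ _ =>
    twoCyclesGlued_adj_succ hk (by omega)

lemma twoCyclesGlued_connected (h1 : 3 ≤ m1) (h2 : 3 ≤ m2) :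
    (twoCyclesGlued m1 m2).Connected := by
  have h0 : ∀ v : Fin (m1 + m2 - 1),
      (twoCyclesGlued m1 m2).Reachable ⟨0, by omega⟩ v := fun v => by
    obtain hv | hv := lt_or_ge v.val m1
    · obtain ⟨p, -⟩ := twoCyclesGlued_exists_walk (Nat.zero_le v.val) v.isLt (.inl hv)
      exact ⟨p⟩
    · obtain ⟨p, -⟩ := twoCyclesGlued_exists_walk hv v.isLt (.inr le_rfl)
      have hadj : (twoCyclesGlued m1 m2).Adj ⟨0, by omega⟩ ⟨m1, by omega⟩ := by
        refine (fromRel_adj _ _ _).2 ⟨by simp only [ne_eq, Fin.mk.injEq]; omega, .inl ?_⟩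
        exact .inr (.inr (.inl ⟨rfl, rfl⟩))
      exact hadj.reachable.trans ⟨p⟩
  exact { preconnected := fun u v => (h0 u).symm.trans (h0 v), nonempty := ⟨⟨0, by omega⟩⟩ }

/-- The distance from the common vertex `0` of the two cycles to the vertex `i`. -/
def twoCyclesDepth (m1 m2 i : ℕ) : ℕ :=
  if i < m1 then min i (m1 - i) else min (i + 1 - m1) (m1 + m2 - 1 - i)

lemma twoCyclesGlued_dist_le_sub {u v : Fin (m1 + m2 - 1)} (huv : u ≤ v)
    (h : v.val < m1 ∨ m1 ≤ u.val) : (twoCyclesGlued m1 m2).dist u v ≤ v.val - u.val := by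
  obtain ⟨p, hp⟩ := twoCyclesGlued_exists_walk (m1 := m1) (m2 := m2) huv v.isLt h
  exact hp ▸ dist_le p

lemma twoCyclesGlued_dist_zero_le (h1 : 3 ≤ m1) (h2 : 3 ≤ m2) (v : Fin (m1 + m2 - 1)) :
    (twoCyclesGlued m1 m2).dist ⟨0, by omega⟩ v ≤ twoCyclesDepth m1 m2 v := by
  have tri : ∀ w : Fin (m1 + m2 - 1), (twoCyclesGlued m1 m2).Adj ⟨0, by omega⟩ w →
      (twoCyclesGlued m1 m2).dist ⟨0, by omega⟩ v ≤ 1 + (twoCyclesGlued m1 m2).dist w v :=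
    fun w hw => by
      have := (twoCyclesGlued_connected h1 h2).dist_triangle (u := ⟨0, by omega⟩) (v := w) (w := v)
      rwa [dist_eq_one_iff_adj.2 hw] at this
  have adj : ∀ k (hk : k < m1 + m2 - 1), k + 1 = m1 ∨ k = m1 ∨ k + 2 = m1 + m2 →
      (twoCyclesGlued m1 m2).Adj ⟨0, by omega⟩ ⟨k, hk⟩ := fun k hk h => by
    simp only [twoCyclesGlued, fromRel_adj, ne_eq, Fin.ext_iff, true_and]
    omega
  have hvlt := v.isLt
  unfold twoCyclesDepth
  split_ifs with hv
  · have a := twoCyclesGlued_dist_le_sub (u := ⟨0, by omega⟩) (Nat.zero_le v.val) (.inl hv)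
    have b := tri ⟨m1 - 1, by omega⟩ (adj _ _ (by omega))
    have c := twoCyclesGlued_dist_le_sub (m2 := m2) (u := v) (v := ⟨m1 - 1, by omega⟩)
      (Fin.mk_le_mk.2 (by omega)) (.inl (by simp only; omega))
    rw [SimpleGraph.dist_comm] at c
    simp only at a b c
    omega
  · have a := tri ⟨m1, by omega⟩ (adj _ _ (by omega))
    have a' := twoCyclesGlued_dist_le_sub (u := ⟨m1, by omega⟩) (v := v)
      (Fin.mk_le_mk.2 (by omega)) (.inr le_rfl)
    have b := tri ⟨m1 + m2 - 2, by omega⟩ (adj _ _ (by omega))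
    have c := twoCyclesGlued_dist_le_sub (u := v) (v := ⟨m1 + m2 - 2, by omega⟩)
      (Fin.mk_le_mk.2 (by omega)) (.inr (by omega))
    rw [SimpleGraph.dist_comm] at c
    simp only at a a' b c
    omega

lemma twoCyclesGlued_dist_le_add (h1 : 3 ≤ m1) (h2 : 3 ≤ m2) (u v : Fin (m1 + m2 - 1)) :
    (twoCyclesGlued m1 m2).dist u v ≤ twoCyclesDepth m1 m2 u + twoCyclesDepth m1 m2 v := by
  have h := (twoCyclesGlued_connected h1 h2).dist_triangle (u := u) (v := ⟨0, by omega⟩) (w := v)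
  rw [SimpleGraph.dist_comm (u := u) (v := ⟨0, by omega⟩)] at h
  exact h.trans (Nat.add_le_add (twoCyclesGlued_dist_zero_le h1 h2 u)
    (twoCyclesGlued_dist_zero_le h1 h2 v))

lemma twoCyclesGlued_dist_le (h1 : 3 ≤ m1) (h2 : 3 ≤ m2) (u v : Fin (m1 + m2 - 1)) :
    (twoCyclesGlued m1 m2).dist u v ≤ m1 / 2 + m2 / 2 := by
  wlog huv : u ≤ v generalizing u v
  · rw [SimpleGraph.dist_comm]
    exact this v u (le_of_not_ge huv)
  have h := twoCyclesGlued_dist_le_add h1 h2 u v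
  have hle : u.val ≤ v.val := huv
  have hv := v.isLt
  unfold twoCyclesDepth at h
  by_cases hc : v.val < m1 ∨ m1 ≤ u.val
  · have := twoCyclesGlued_dist_le_sub huv hc
    split_ifs at h <;> omega
  · split_ifs at h <;> omega

lemma totalEcc_twoCyclesGlued_lt (h1 : 3 ≤ m1) (h2 : 3 ≤ m2) :
    totalEcc (twoCyclesGlued m1 m2) < (m1 + m2 - 1) * (m1 / 2 + m2 / 2) := by
  have h : totalEcc (twoCyclesGlued m1 m2) <
      ∑ _v : Fin (m1 + m2 - 1), (m1 / 2 + m2 / 2) := by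
    refine Finset.sum_lt_sum
      (fun v _ => ecc_le_of_dist_le (twoCyclesGlued_dist_le h1 h2 v))
      ⟨⟨0, by omega⟩, Finset.mem_univ _, ?_⟩
    refine Nat.lt_of_le_pred (by omega) (ecc_le_of_dist_le fun u => ?_)
    refine (twoCyclesGlued_dist_zero_le h1 h2 u).trans ?_
    have := u.isLt
    unfold twoCyclesDepth
    rw [Nat.pred_eq_sub_one]
    split_ifs <;> omega
  simpa using h

lemma totalEcc_twoCyclesGlued_four_four : totalEcc (twoCyclesGlued 4 4) ≤ 22 := by
  have h : totalEcc (twoCyclesGlued 4 4) ≤ ∑ v : Fin 7, (twoCyclesDepth 4 4 v + 2) := by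
    refine Finset.sum_le_sum fun v _ => ecc_le_of_dist_le fun u => ?_
    refine (twoCyclesGlued_dist_le_add (by norm_num) (by norm_num) v u).trans ?_
    have : twoCyclesDepth 4 4 u ≤ 2 := by
      unfold twoCyclesDepth
      split_ifs <;> omega
    omega
  exact h.trans (by decide)

end twoCyclesGlued

-- STATEMENT 7
theorem stmt7 (m1 m2 n : ℕ) (h1 : 3 ≤ m1) (h2 : 3 ≤ m2)
    (hn : n = m1 + m2 - 1) (h7 : 7 ≤ n) :
    totalEcc (twoCyclesGlued m1 m2) < totalEcc (C33 n) := by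
  obtain ⟨t, s, rfl, hst, hts⟩ : ∃ t s, n = t + s + 3 ∧ s ≤ t ∧ t ≤ s + 1 :=
    ⟨(n - 2) / 2, (n - 3) / 2, by omega, by omega, by omega⟩
  have hC := le_two_mul_totalEcc_C33 (t := t) (s := s) (by omega)
  have hG := totalEcc_twoCyclesGlued_lt h1 h2
  by_cases h44 : m1 = 4 ∧ m2 = 4
  · obtain ⟨rfl, rfl⟩ := h44
    obtain ⟨rfl, rfl⟩ : t = 2 ∧ s = 2 := by omega
    have := totalEcc_twoCyclesGlued_four_four
    omega
  replace hG := hG.trans_eq (congrArg (· * (m1 / 2 + m2 / 2)) hn.symm)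
  have hab : m1 / 2 + m2 / 2 ≤ s + 2 := by omega
  obtain rfl | rfl : t = s ∨ t = s + 1 := by omega
  · obtain rfl | ht : t = 2 ∨ 3 ≤ t := by omega
    · have hab' : m1 / 2 + m2 / 2 ≤ 3 := by omega
      omega
    · have := Nat.mul_le_mul_left (t + t + 3) hab
      nlinarith
  · have := Nat.mul_le_mul_left (s + 1 + s + 3) hab
    have : 2 ≤ s := by omega
    nlinarith
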